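/- Let H be an infinite-dimensional complex Hilbert space, let r and s be positive rational numbers with r + s > 1, and let φ : S(H) → S(H) be a surjective map satisfying σ(|A|^r B |A|^s) = σ(|φ(A)|^r φ(B) |φ(A)|^s) for every A in P₁(H) ∪ {I} and every B ∈ S(H). Then σ(B) = σ(φ(B)) for all B ∈ S(H). -/

import Mathlib

/-- The absolute value `|A| = (A* A)^(1/2)`, via the continuous functional calculus. -/
noncomputable def absOp {H : Type*} [NormedAddCommGroup H] [InnerProductSpace ℂ H]
    [CompleteSpace H] (A : H →L[ℂ] H) : H →L[ℂ] H :=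
  cfc (fun t : ℝ => Real.sqrt t) (star A * A)

/-- The power `|A|^r`, via the continuous functional calculus. -/
noncomputable def absPow {H : Type*} [NormedAddCommGroup H] [InnerProductSpace ℂ H]
    [CompleteSpace H] (A : H →L[ℂ] H) (r : ℝ) : H →L[ℂ] H :=
  cfc (fun t : ℝ => t ^ r) (absOp A)

/-- An operator has rank one when its range is a one-dimensional subspace. -/
def IsRankOne {H : Type*} [NormedAddCommGroup H] [InnerProductSpace ℂ H]
    (A : H →L[ℂ] H) : Prop :=
  Module.finrank ℂ (LinearMap.range (A : H →ₗ[ℂ] H)) = 1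

/-- A rank-one projection: a self-adjoint idempotent of rank one. -/
def IsRankOneProjection {H : Type*} [NormedAddCommGroup H] [InnerProductSpace ℂ H]
    [CompleteSpace H] (A : H →L[ℂ] H) : Prop :=
  IsSelfAdjoint A ∧ A * A = A ∧ IsRankOne A

open scoped InnerProductSpace

theorem absPow_eq {H : Type*} [NormedAddCommGroup H] [InnerProductSpace ℂ H]
    [CompleteSpace H] (J : H →L[ℂ] H) (hJ : IsSelfAdjoint J) (r : ℝ) (hr : 0 < r) :
    absPow J r = cfc (fun t : ℝ => |t| ^ r) J := by
  have h1 : absOp J = cfc (fun t : ℝ => |t|) J := by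
    unfold absOp
    have h2 : star J * J = cfc (fun t : ℝ => t * t) J := by
      rw [cfc_mul (fun t : ℝ => t) (fun t : ℝ => t) J, cfc_id' ℝ J, hJ.star_eq]
    rw [h2, ← cfc_comp' (fun t : ℝ => Real.sqrt t) (fun t : ℝ => t * t) J
      (Real.continuous_sqrt.continuousOn)]
    simp only [Real.sqrt_mul_self_eq_abs]
  unfold absPow
  rw [h1, ← cfc_comp' (fun t : ℝ => t ^ r) (fun t : ℝ => |t|) J
    ((Real.continuous_rpow_const hr.le).continuousOn)]

theorem preserver_spectrum
    {H : Type*} [NormedAddCommGroup H] [InnerProductSpace ℂ H] [CompleteSpace H]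
    (hH : ¬ FiniteDimensional ℂ H)
    (r s : ℚ) (hr : 0 < r) (hs : 0 < s) (hrs : 1 < r + s)
    (φ : selfAdjoint (H →L[ℂ] H) → selfAdjoint (H →L[ℂ] H))
    (hφ : Function.Surjective φ)
    (hspec : ∀ A : selfAdjoint (H →L[ℂ] H),
      (IsRankOneProjection (A : H →L[ℂ] H) ∨ (A : H →L[ℂ] H) = 1) →
      ∀ B : selfAdjoint (H →L[ℂ] H),
        spectrum ℂ (absPow (A : H →L[ℂ] H) r * (B : H →L[ℂ] H) * absPow (A : H →L[ℂ] H) s) =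
        spectrum ℂ (absPow (φ A : H →L[ℂ] H) r * (φ B : H →L[ℂ] H) *
          absPow (φ A : H →L[ℂ] H) s)):
    ∀ B : selfAdjoint (H →L[ℂ] H),
      spectrum ℂ (B : H →L[ℂ] H) = spectrum ℂ (φ B : H →L[ℂ] H) := by
  have hr' : (0:ℝ) < r := by exact_mod_cast hr
  have hs' : (0:ℝ) < s := by exact_mod_cast hs
  have : Nontrivial H := by
    by_contra h
    rw [not_nontrivial_iff_subsingleton] at h
    exact hH inferInstance
  have h1 : ∀ p : ℝ, 0 < p → absPow (1 : H →L[ℂ] H) p = 1 := by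
    intro p hp
    rw [absPow_eq 1 (IsSelfAdjoint.one _) p hp, cfc_apply_one]
    simp
  have hI := hspec 1 (Or.inr rfl)
  simp only [selfAdjoint.val_one, h1 _ hr', h1 _ hs', one_mul, mul_one] at hI
  have hJ : φ 1 = 1 := by
    have h := hI 1
    set J := φ 1 with hJdef
    have hsa : IsSelfAdjoint (J : H →L[ℂ] H) := J.2
    have cr : Continuous (fun t : ℝ => |t| ^ (r:ℝ)) :=
      (Real.continuous_rpow_const hr'.le).comp continuous_abs
    have cs : Continuous (fun t : ℝ => |t| ^ (s:ℝ)) :=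
      (Real.continuous_rpow_const hs'.le).comp continuous_abs
    have e : absPow (J : H →L[ℂ] H) r * J * absPow (J : H →L[ℂ] H) s =
        cfc (fun t : ℝ => |t| ^ (r:ℝ) * t * |t| ^ (s:ℝ)) (J : H →L[ℂ] H) := by
      rw [cfc_mul (fun t : ℝ => |t| ^ (r:ℝ) * t) (fun t : ℝ => |t| ^ (s:ℝ)) _
        (cr.mul continuous_id).continuousOn cs.continuousOn,
        cfc_mul (fun t : ℝ => |t| ^ (r:ℝ)) (fun t : ℝ => t) _ cr.continuousOn,
        cfc_id' ℝ (J : H →L[ℂ] H), absPow_eq _ hsa _ hr', absPow_eq _ hsa _ hs']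
    rw [e, selfAdjoint.val_one, spectrum.one_eq] at h
    have hm : ∀ t ∈ spectrum ℝ (J : H →L[ℂ] H), t = 1 := by
      intro t ht
      have h2 : |t| ^ (r:ℝ) * t * |t| ^ (s:ℝ) ∈
          spectrum ℝ (cfc (fun t : ℝ => |t| ^ (r:ℝ) * t * |t| ^ (s:ℝ)) (J : H →L[ℂ] H)) := by
        rw [cfc_map_spectrum (fun t : ℝ => |t| ^ (r:ℝ) * t * |t| ^ (s:ℝ)) _ hsa
          ((cr.mul continuous_id).mul cs).continuousOn]
        exact ⟨t, ht, rfl⟩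
      have h3 := spectrum.algebraMap_mem ℂ h2
      rw [← h, Set.mem_singleton_iff] at h3
      have h4 : |t| ^ (r:ℝ) * t * |t| ^ (s:ℝ) = 1 := by
        simpa only [Complex.coe_algebraMap, Complex.ofReal_eq_one] using h3
      have ha : 0 ≤ |t| ^ (r:ℝ) := by positivity
      have hb : 0 ≤ |t| ^ (s:ℝ) := by positivity
      have ht0 : 0 < t := by
        by_contra hn
        push Not at hn
        have := mul_nonneg ha hb
        nlinarith
      rw [abs_of_pos ht0] at h4
      rcases lt_trichotomy t 1 with hl | hl | hl
      · have a1 := Real.rpow_lt_one ht0.le hl hr'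
        have a2 := Real.rpow_lt_one ht0.le hl hs'
        have a3 := mul_lt_one_of_nonneg_of_lt_one_left (by positivity) a1 hl.le
        have a4 := mul_lt_one_of_nonneg_of_lt_one_left (by positivity) a3 a2.le
        linarith
      · exact hl
      · have a1 := Real.one_lt_rpow hl hr'
        have a2 := Real.one_lt_rpow hl hs'
        have a3 := one_lt_mul_of_lt_of_le a1 hl.le
        have a4 := one_lt_mul_of_lt_of_le a3 a2.le
        linarith
    apply Subtype.ext
    rw [selfAdjoint.val_one, ← cfc_id' ℝ (J : H →L[ℂ] H), cfc_congr (g := fun _ => (1:ℝ)) hm,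
      cfc_const_one ℝ (J : H →L[ℂ] H)]
  simpa only [hJ, selfAdjoint.val_one, h1 _ hr', h1 _ hs', one_mul, mul_one] using hI
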